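/- Let r ≥ 2 and n ≥ d ≥ 1 be integers with n ≥ 2. If H ⊆ {1,...,r,⋆}^{[n]} is a partial class with VC(H) ≤ d, then C(H) ≤ n^{(r-1)·d·log₂(n+1)}. -/

import Mathlib

/-- A set `S ⊆ [n]` is shattered by a partial class `H ⊆ {1,…,r,⋆}^[n]`
(`⋆` is encoded as `none`) if the restriction of `H` to `S` contains every
total function `S → {1,…,r}`. -/
def IsShattered (n r : ℕ) (H : Set (Fin n → Option (Fin r))) (S : Finset (Fin n)) : Prop :=
  ∀ g : Fin n → Fin r, ∃ h ∈ H, ∀ i ∈ S, h i = some (g i)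

/-- `VCDimLE n r H d` means the VC-dimension of the partial class `H` is at most `d`. -/
def VCDimLE (n r : ℕ) (H : Set (Fin n → Option (Fin r))) (d : ℕ) : Prop :=
  ∀ S : Finset (Fin n), IsShattered n r H S → S.card ≤ d

/-- A total class `F` is a net of the partial class `H` if for every `h ∈ H`
there is `f ∈ F` with `h i ≠ f i` for all `i`. -/
def IsNet {ι α : Type*} (H : Set (ι → Option α)) (F : Finset (ι → α)) : Prop :=
  ∀ h ∈ H, ∃ f ∈ F, ∀ i, h i ≠ some (f i)

/-- The covering number `C(H)`: the minimum size of a net of `H`. -/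
noncomputable def coveringNumber {ι α : Type*} (H : Set (ι → Option α)) : ℕ :=
  sInf {m | ∃ F : Finset (ι → α), IsNet H F ∧ F.card = m}

open scoped Classical in
/-- The number of sets shattered by a partial class. -/
noncomputable def numShattered {n r : ℕ} (H : Set (Fin n → Option (Fin r))) : ℕ :=
  ∑ S : Finset (Fin n), if IsShattered n r H S then 1 else 0

theorem IsShattered.mono {n r : ℕ} {H K : Set (Fin n → Option (Fin r))} {S : Finset (Fin n)}
    (hHK : H ⊆ K) (hS : IsShattered n r H S) : IsShattered n r K S := fun g => by
  obtain ⟨h, hh, hg⟩ := hS g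
  exact ⟨h, hHK hh, hg⟩

theorem not_isShattered_slice_of_mem {n r : ℕ} (hr : 2 ≤ r) (H : Set (Fin n → Option (Fin r)))
    {a : Fin n} (j : Fin r) {S : Finset (Fin n)} (ha : a ∈ S) :
    ¬ IsShattered n r {h ∈ H | h a = some j} S := by
  intro hS
  have : Nontrivial (Fin r) := Fin.nontrivial_iff_two_le.2 hr
  obtain ⟨k, hk⟩ := exists_ne j
  obtain ⟨h, hh, hg⟩ := hS fun _ => k
  have := hg a ha
  rw [hh.2] at this
  exact hk (Option.some.inj this).symm

theorem isShattered_insert_of_forall_slice {n r : ℕ} (H : Set (Fin n → Option (Fin r)))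
    (a : Fin n) {S : Finset (Fin n)}
    (hS : ∀ j, IsShattered n r {h ∈ H | h a = some j} S) :
    IsShattered n r H (insert a S) := by
  intro g
  obtain ⟨h, hh, hg⟩ := hS (g a) g
  refine ⟨h, hh.1, fun i hi => ?_⟩
  rcases Finset.mem_insert.1 hi with rfl | hi
  · exact hh.2
  · exact hg i hi

theorem sum_numShattered_slice_le {n r : ℕ} (hr : 2 ≤ r) (H : Set (Fin n → Option (Fin r)))
    (a : Fin n) :
    ∑ j, numShattered {h ∈ H | h a = some j} ≤ (r - 1) * numShattered H := by
  classical
  have split (f : Finset (Fin n) → ℕ) : ∑ S, f S =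
      ∑ S ∈ (Finset.univ.erase a).powerset, f S +
        ∑ S ∈ (Finset.univ.erase a).powerset, f (insert a S) := by
    rw [← Finset.sum_powerset_insert (Finset.notMem_erase a Finset.univ),
      Finset.insert_erase (Finset.mem_univ a), Finset.powerset_univ]
  simp only [numShattered]
  rw [Finset.sum_comm, split, split, ← Finset.sum_add_distrib, ← Finset.sum_add_distrib,
    Finset.mul_sum]
  refine Finset.sum_le_sum fun S _ => ?_
  have hzero : ∀ j, ¬ IsShattered n r {h ∈ H | h a = some j} (insert a S) := fun j =>
    not_isShattered_slice_of_mem hr H j (Finset.mem_insert_self a S)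
  simp only [hzero, if_false, Finset.sum_const_zero, add_zero, ← Finset.card_filter]
  by_cases hall : ∀ j, IsShattered n r {h ∈ H | h a = some j} S
  · have h1 := isShattered_insert_of_forall_slice H a hall
    have h2 : IsShattered n r H S := (hall ⟨0, by omega⟩).mono (Set.sep_subset _ _)
    simp only [hall, h1, h2, if_true, Finset.filter_true, Finset.card_univ, Fintype.card_fin]
    omega
  · by_cases hex : ∃ j, IsShattered n r {h ∈ H | h a = some j} S
    · obtain ⟨j, hj⟩ := hex
      have h2 : IsShattered n r H S := hj.mono (Set.sep_subset _ _)
      push Not at hall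
      obtain ⟨k, hk⟩ := hall
      have hlt : (Finset.univ.filter fun j => IsShattered n r {h ∈ H | h a = some j} S).card
          < (Finset.univ : Finset (Fin r)).card :=
        Finset.card_lt_card (Finset.filter_ssubset.2 ⟨k, Finset.mem_univ k, hk⟩)
      rw [Finset.card_univ, Fintype.card_fin] at hlt
      rw [if_pos h2]
      refine le_trans (by omega : _ ≤ (r - 1) * 1) (Nat.mul_le_mul_left _ (by omega))
    · push Not at hex
      simp [hex]

theorem exists_numShattered_slice_le {n r : ℕ} (hr : 2 ≤ r) (H : Set (Fin n → Option (Fin r)))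
    (a : Fin n) :
    ∃ j, r * numShattered {h ∈ H | h a = some j} ≤ (r - 1) * numShattered H := by
  have : Nonempty (Fin r) := ⟨⟨0, by omega⟩⟩
  obtain ⟨j, hj⟩ := Finite.exists_min fun j => numShattered {h ∈ H | h a = some j}
  refine ⟨j, le_trans ?_ (sum_numShattered_slice_le hr H a)⟩
  simpa using Finset.card_nsmul_le_sum Finset.univ
    (fun j => numShattered {h ∈ H | h a = some j}) _ fun k _ => hj k

theorem eq_empty_of_numShattered_eq_zero {n r : ℕ} {H : Set (Fin n → Option (Fin r))}
    (h0 : numShattered H = 0) : H = ∅ := by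
  classical
  by_contra hne
  obtain ⟨h, hh⟩ := Set.nonempty_iff_ne_empty.2 hne
  have := Finset.sum_eq_zero_iff.1 h0 ∅ (Finset.mem_univ _)
  have hs : IsShattered n r H ∅ := fun _ => ⟨h, hh, by simp⟩
  simp [hs] at this

theorem sum_range_choose_succ_succ (t m : ℕ) :
    ∑ k ∈ Finset.range (m + 1), (t + 1).choose k =
      ∑ k ∈ Finset.range (m + 1), t.choose k + ∑ k ∈ Finset.range m, t.choose k := by
  rw [Finset.sum_range_succ', Finset.sum_range_succ' (fun k => t.choose k)]
  simp only [Nat.choose_succ_succ, Finset.sum_add_distrib, Nat.choose_zero_right]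
  ring

/-- A class with few shattered sets has a small net on any set of coordinates. -/
theorem exists_net_on_of_numShattered_lt {n r : ℕ} (hr : 2 ≤ r) (T : Finset (Fin n)) :
    ∀ (m : ℕ) (H : Set (Fin n → Option (Fin r))),
      (r - 1) ^ m * numShattered H < r ^ m →
      ∃ F : Finset (Fin n → Fin r),
        (∀ h ∈ H, ∃ f ∈ F, ∀ i ∈ T, h i ≠ some (f i)) ∧
        F.card ≤ ∑ k ∈ Finset.range m, T.card.choose k := by
  classical
  induction T using Finset.induction_on with
  | empty =>
    intro m H hH
    rcases m with _ | m
    · obtain rfl : H = ∅ := eq_empty_of_numShattered_eq_zero (by simpa using hH)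
      exact ⟨∅, by simp⟩
    · refine ⟨{fun _ => ⟨0, by omega⟩}, by simp, ?_⟩
      rw [Finset.sum_range_succ']
      simp
  | insert a T ha ih =>
    intro m H hH
    rcases m with _ | m
    · obtain rfl : H = ∅ := eq_empty_of_numShattered_eq_zero (by simpa using hH)
      exact ⟨∅, by simp⟩
    · have : Nontrivial (Fin r) := Fin.nontrivial_iff_two_le.2 hr
      obtain ⟨j, hj⟩ := exists_numShattered_slice_le hr H a
      obtain ⟨k, hk⟩ := exists_ne j
      obtain ⟨F, hF, hFc⟩ := ih (m + 1) H hH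
      obtain ⟨G, hG, hGc⟩ := ih m {h ∈ H | h a = some j} <| by
        refine lt_of_mul_lt_mul_left (a := r) ?_ (Nat.zero_le r)
        calc r * ((r - 1) ^ m * numShattered {h ∈ H | h a = some j})
            = (r - 1) ^ m * (r * numShattered {h ∈ H | h a = some j}) := by ring
          _ ≤ (r - 1) ^ m * ((r - 1) * numShattered H) := Nat.mul_le_mul_left _ hj
          _ = (r - 1) ^ (m + 1) * numShattered H := by ring
          _ < r ^ (m + 1) := hH
          _ = r * r ^ m := by ring
      refine ⟨F.image (fun f => Function.update f a j) ∪
        G.image (fun f => Function.update f a k), fun h hh => ?_, ?_⟩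
      · have key (f : Fin n → Fin r) (l : Fin r) (hl : h a ≠ some l)
            (hf : ∀ i ∈ T, h i ≠ some (f i)) :
            ∀ i ∈ insert a T, h i ≠ some (Function.update f a l i) := by
          intro i hi
          rcases Finset.mem_insert.1 hi with rfl | hi
          · simpa using hl
          · rw [Function.update_of_ne (ne_of_mem_of_not_mem hi ha)]
            exact hf i hi
        by_cases hha : h a = some j
        · obtain ⟨f, hf, hfT⟩ := hG h ⟨hh, hha⟩
          refine ⟨_, Finset.mem_union_right _ (Finset.mem_image_of_mem _ hf),
            key f k ?_ hfT⟩
          rw [hha]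
          exact fun e => hk (Option.some.inj e).symm
        · obtain ⟨f, hf, hfT⟩ := hF h hh
          exact ⟨_, Finset.mem_union_left _ (Finset.mem_image_of_mem _ hf), key f j hha hfT⟩
      · rw [Finset.card_insert_of_notMem ha, sum_range_choose_succ_succ]
        exact (Finset.card_union_le _ _).trans
          (add_le_add (Finset.card_image_le.trans hFc) (Finset.card_image_le.trans hGc))

theorem coveringNumber_le_of_numShattered_lt {n r m : ℕ} (hr : 2 ≤ r)
    {H : Set (Fin n → Option (Fin r))} (hH : (r - 1) ^ m * numShattered H < r ^ m) :
    coveringNumber H ≤ ∑ k ∈ Finset.range m, n.choose k := by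
  obtain ⟨F, hF, hFc⟩ := exists_net_on_of_numShattered_lt hr Finset.univ m H hH
  rw [Finset.card_univ, Fintype.card_fin] at hFc
  refine le_trans (Nat.sInf_le ⟨F, fun h hh => ?_, rfl⟩) hFc
  obtain ⟨f, hf, hfi⟩ := hF h hh
  exact ⟨f, hf, fun i => hfi i (Finset.mem_univ i)⟩

theorem sum_range_succ_choose_le_add_one_pow (n d : ℕ) :
    ∑ k ∈ Finset.range (d + 1), n.choose k ≤ (n + 1) ^ d := by
  induction d with
  | zero => simp
  | succ d ih =>
    rw [Finset.sum_range_succ]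
    calc _ ≤ (n + 1) ^ d + n ^ (d + 1) := add_le_add ih (Nat.choose_le_pow n (d + 1))
      _ ≤ (n + 1) ^ d + n * (n + 1) ^ d := by
        rw [pow_succ' n]
        gcongr
        omega
      _ = (n + 1) ^ (d + 1) := by ring

theorem sum_range_succ_choose_le_pow {n m : ℕ} (hn : 2 ≤ n) (hm : 2 ≤ m) :
    ∑ k ∈ Finset.range (m + 1), n.choose k ≤ n ^ m := by
  obtain ⟨n, rfl⟩ := Nat.exists_eq_add_of_le' (show 1 ≤ n by omega)
  induction m, hm using Nat.le_induction with
  | base =>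
    have h := Nat.choose_succ_right_eq (n + 1) 1
    simp only [Finset.sum_range_succ, Finset.sum_range_zero, Nat.choose_zero_right,
      Nat.choose_one_right, Nat.add_sub_cancel] at h ⊢
    nlinarith
  | succ m hm ih =>
    have h : (n + 1).choose (m + 1) ≤ (n + 1) ^ m * n :=
      calc (n + 1).choose (m + 1) ≤ (n + 1).choose (m + 1) * (m + 1) :=
            Nat.le_mul_of_pos_right _ (by omega)
        _ = (n + 1).choose m * (n + 1 - m) := Nat.choose_succ_right_eq _ _
        _ ≤ (n + 1) ^ m * n := Nat.mul_le_mul (Nat.choose_le_pow _ _) (by omega)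
    rw [Finset.sum_range_succ, pow_succ]
    linarith

theorem numShattered_le_of_vcDimLE {n r d : ℕ} {H : Set (Fin n → Option (Fin r))}
    (hVC : VCDimLE n r H d) : numShattered H ≤ (n + 1) ^ d := by
  classical
  refine le_trans ?_ (sum_range_succ_choose_le_add_one_pow n d)
  rw [numShattered, ← Finset.card_filter]
  have hsub : (Finset.univ.filter fun S => IsShattered n r H S) ⊆
      (Finset.range (d + 1)).biUnion fun k => Finset.powersetCard k Finset.univ := by
    intro S hS
    have := hVC S (Finset.mem_filter.1 hS).2
    simp only [Finset.mem_biUnion, Finset.mem_range, Finset.mem_powersetCard]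
    exact ⟨S.card, by omega, Finset.subset_univ S, rfl⟩
  refine (Finset.card_le_card hsub).trans (Finset.card_biUnion_le.trans (le_of_eq ?_))
  simp

/-- Since `(1 + 1 / (r - 1)) ^ (r - 1) ≥ 2`, the exponent `(r - 1) log₂ M` suffices to exceed
`M` with powers of `r / (r - 1)`. -/
theorem pred_pow_mul_lt_pow_of_logb_lt {r m M : ℕ} (hr : 2 ≤ r) (hM : 1 ≤ M)
    (hm : ((r : ℝ) - 1) * Real.logb 2 M < m) : (r - 1) ^ m * M < r ^ m := by
  obtain ⟨s, rfl⟩ := Nat.exists_eq_add_of_le' (show 1 ≤ r by omega)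
  have hs : (0 : ℝ) < s := by exact_mod_cast (by omega : 0 < s)
  have hM' : (0 : ℝ) < M := by exact_mod_cast hM
  have hq : (1 : ℝ) < 1 + 1 / s := by simpa using hs
  have h2 : (2 : ℝ) ≤ (1 + 1 / s) ^ s := by
    have := one_add_mul_le_pow (a := 1 / (s : ℝ)) (by linarith) s
    rw [mul_one_div_cancel hs.ne'] at this
    linarith
  have hlog : 0 ≤ Real.logb 2 M := Real.logb_nonneg (by norm_num) (by exact_mod_cast hM)
  have hlt : (M : ℝ) < (1 + 1 / s) ^ m :=
    calc (M : ℝ) = 2 ^ Real.logb 2 M := (Real.rpow_logb (by norm_num) (by norm_num) hM').symm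
      _ ≤ ((1 + 1 / s : ℝ) ^ s) ^ Real.logb 2 M := Real.rpow_le_rpow (by norm_num) h2 hlog
      _ = (1 + 1 / s : ℝ) ^ (s * Real.logb 2 M) := by
        rw [← Real.rpow_natCast, ← Real.rpow_mul (by linarith)]
      _ < (1 + 1 / s : ℝ) ^ (m : ℝ) :=
        Real.rpow_lt_rpow_of_exponent_lt hq (by push_cast at hm; simpa using hm)
      _ = (1 + 1 / s) ^ m := Real.rpow_natCast _ _
  have : ((s : ℝ) ^ m * M) < (s + 1) ^ m :=
    calc (s : ℝ) ^ m * M < s ^ m * (1 + 1 / s) ^ m :=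
          mul_lt_mul_of_pos_left hlt (pow_pos hs m)
      _ = (s + 1) ^ m := by
        rw [← mul_pow, mul_add, mul_one_div_cancel hs.ne', mul_one]
  rw [Nat.add_sub_cancel]
  exact_mod_cast this

/-- Let `r ≥ 2` and `n ≥ d ≥ 1` with `n ≥ 2`. If `H ⊆ {1,…,r,⋆}^[n]` is a partial class
with `VC(H) ≤ d`, then `C(H) ≤ n^{(r-1)·d·log₂(n+1)}`. -/
theorem stmt4 (r n d : ℕ) (hr : 2 ≤ r) (hd : 1 ≤ d) (hdn : d ≤ n) (hn : 2 ≤ n)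
    (H : Set (Fin n → Option (Fin r))) (hVC : VCDimLE n r H d) :
    (coveringNumber H : ℝ) ≤
      (n : ℝ) ^ (((r : ℝ) - 1) * (d : ℝ) * Real.logb 2 ((n : ℝ) + 1)) := by
  have hr' : (1 : ℝ) ≤ (r : ℝ) - 1 := by
    have : (2 : ℝ) ≤ r := by exact_mod_cast hr
    linarith
  have hd' : (1 : ℝ) ≤ d := by exact_mod_cast hd
  have hn' : (2 : ℝ) ≤ n := by exact_mod_cast hn
  have hlog : 0 ≤ Real.logb 2 ((n : ℝ) + 1) := Real.logb_nonneg (by norm_num) (by linarith)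
  set L : ℝ := ((r : ℝ) - 1) * (d : ℝ) * Real.logb 2 ((n : ℝ) + 1) with hL
  have hlogL : Real.logb 2 ((n : ℝ) + 1) ≤ L :=
    le_mul_of_one_le_left hlog (one_le_mul_of_one_le_of_one_le hr' hd')
  have hcov : coveringNumber H ≤ ∑ k ∈ Finset.range (⌊L⌋₊ + 1), n.choose k := by
    refine coveringNumber_le_of_numShattered_lt hr (lt_of_le_of_lt
      (Nat.mul_le_mul_left _ (numShattered_le_of_vcDimLE hVC))
      (pred_pow_mul_lt_pow_of_logb_lt hr (Nat.one_le_pow' d n) ?_))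
    push_cast
    rw [Real.logb_pow, ← mul_assoc]
    exact Nat.lt_floor_add_one L
  by_cases h2 : 2 ≤ ⌊L⌋₊
  · calc (coveringNumber H : ℝ) ≤ (n : ℝ) ^ ⌊L⌋₊ := by
          exact_mod_cast hcov.trans (sum_range_succ_choose_le_pow hn h2)
      _ = (n : ℝ) ^ ((⌊L⌋₊ : ℕ) : ℝ) := (Real.rpow_natCast _ _).symm
      _ ≤ (n : ℝ) ^ L :=
        Real.rpow_le_rpow_of_exponent_le (by linarith) (Nat.floor_le (hlog.trans hlogL))
  · have hL1 : ⌊L⌋₊ ≤ 1 := by omega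
    calc (coveringNumber H : ℝ) ≤ (n : ℝ) + 1 := by
          have h := hcov.trans (Finset.sum_le_sum_of_subset
            (Finset.range_mono (Nat.succ_le_succ hL1)))
          simp only [Finset.sum_range_succ, Finset.sum_range_zero, Nat.choose_zero_right,
            Nat.choose_one_right] at h
          exact_mod_cast (by omega : coveringNumber H ≤ n + 1)
      _ = 2 ^ Real.logb 2 ((n : ℝ) + 1) :=
        (Real.rpow_logb (by norm_num) (by norm_num) (by linarith)).symm
      _ ≤ (n : ℝ) ^ Real.logb 2 ((n : ℝ) + 1) := Real.rpow_le_rpow (by norm_num) hn' hlog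
      _ ≤ (n : ℝ) ^ L := Real.rpow_le_rpow_of_exponent_le (by linarith) hlogL
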